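/- Let A_n = ∏_{k=0}^{n−1} (2^{2k} (k!)^4 / ((2k)!)^2) · 2/(2k+1). Then as n → ∞, A_n = e^{c₀} n^{−1/4} (2π)^n 2^{−n²} (1 + o(1)), where c₀ = (1/12) ln 2 + 3ζ'(−1). -/

import Mathlib

open Filter

/-- Truncated Euler–Maclaurin approximation to the Riemann zeta function. -/
noncomputable def zetaApprox (n : ℕ) (s : ℂ) : ℂ :=
  ∑ k ∈ Finset.range n, ((k : ℂ) + 1) ^ (-s) - (n : ℂ) ^ (-s + 1) / (-s + 1)
    - (n : ℂ) ^ (-s) / 2 + s * (n : ℂ) ^ (-s - 1) / 12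

lemma hasDerivAt_ofReal_cpow_const_of_pos {x : ℝ} (hx : 0 < x) (p : ℂ) :
    HasDerivAt (fun y : ℝ => (y : ℂ) ^ p) (p * (x : ℂ) ^ (p - 1)) x := by
  have h := (hasDerivAt_id (x : ℂ)).cpow_const (c := p) (Or.inl (by simpa using hx))
  simpa using! h.comp_ofReal

lemma hasDerivAt_eulerMaclaurin_primitive {s : ℂ} (hs : s ≠ 1) (a : ℝ) {x : ℝ} (hx : 0 < x) :
    HasDerivAt (fun y : ℝ =>
      (((y - a) ^ 3 - 3 / 2 * (y - a) ^ 2 + (y - a) / 2) / 6 : ℂ)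
          * (-s * ((-s - 1) * (y : ℂ) ^ (-s - 2)))
        - ((3 * (y - a) ^ 2 - 3 * (y - a) + 1 / 2) / 6 : ℂ) * (-s * (y : ℂ) ^ (-s - 1))
        + (y - a - 1 / 2 : ℂ) * (y : ℂ) ^ (-s) - (y : ℂ) ^ (-s + 1) / (-s + 1))
      ((((x - a) ^ 3 - 3 / 2 * (x - a) ^ 2 + (x - a) / 2) / 6 : ℂ)
        * (-s * ((-s - 1) * ((-s - 2) * (x : ℂ) ^ (-s - 3))))) x := by
  have hd : HasDerivAt (fun y : ℝ => ((y : ℂ) - a)) 1 x := by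
    simpa using! ((hasDerivAt_id (x : ℂ)).sub_const (a : ℂ)).comp_ofReal
  have e0 := hasDerivAt_ofReal_cpow_const_of_pos hx (-s + 1)
  have e1 := hasDerivAt_ofReal_cpow_const_of_pos hx (-s)
  have e2 := hasDerivAt_ofReal_cpow_const_of_pos hx (-s - 1)
  have e3 := hasDerivAt_ofReal_cpow_const_of_pos hx (-s - 2)
  rw [show -s + 1 - 1 = -s by ring] at e0
  rw [show -s - 1 - 1 = -s - 2 by ring] at e2
  rw [show -s - 2 - 1 = -s - 3 by ring] at e3
  have hs' : -s + 1 ≠ 0 := fun h => hs (by linear_combination -h)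
  have p3 := (((hd.pow 3).sub ((hd.pow 2).const_mul (3 / 2 : ℂ))).add (hd.div_const 2)).div_const 6
  have p2 := ((((hd.pow 2).const_mul (3 : ℂ)).sub (hd.const_mul (3 : ℂ))).add_const
    (1 / 2 : ℂ)).div_const 6
  have p1 := hd.sub_const (1 / 2 : ℂ)
  convert! (((p3.mul ((e3.const_mul (-s - 1)).const_mul (-s))).sub
    (p2.mul (e2.const_mul (-s)))).add (p1.mul e1)).sub (e0.div_const (-s + 1)) using 1
  simp only [Pi.add_apply, Pi.sub_apply, Pi.pow_apply]
  field_simp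
  push_cast
  ring

lemma zetaApprox_sub (n : ℕ) (s : ℂ) :
    zetaApprox (n + 2) s - zetaApprox (n + 1) s =
      (fun y : ℝ =>
      (((y - (n + 1 : ℝ)) ^ 3 - 3 / 2 * (y - (n + 1 : ℝ)) ^ 2 + (y - (n + 1 : ℝ)) / 2) / 6 : ℂ)
          * (-s * ((-s - 1) * (y : ℂ) ^ (-s - 2)))
        - ((3 * (y - (n + 1 : ℝ)) ^ 2 - 3 * (y - (n + 1 : ℝ)) + 1 / 2) / 6 : ℂ)
          * (-s * (y : ℂ) ^ (-s - 1))
        + (y - (n + 1 : ℝ) - 1 / 2 : ℂ) * (y : ℂ) ^ (-s) - (y : ℂ) ^ (-s + 1) / (-s + 1)) (n + 2)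
      - (fun y : ℝ =>
      (((y - (n + 1 : ℝ)) ^ 3 - 3 / 2 * (y - (n + 1 : ℝ)) ^ 2 + (y - (n + 1 : ℝ)) / 2) / 6 : ℂ)
          * (-s * ((-s - 1) * (y : ℂ) ^ (-s - 2)))
        - ((3 * (y - (n + 1 : ℝ)) ^ 2 - 3 * (y - (n + 1 : ℝ)) + 1 / 2) / 6 : ℂ)
          * (-s * (y : ℂ) ^ (-s - 1))
        + (y - (n + 1 : ℝ) - 1 / 2 : ℂ) * (y : ℂ) ^ (-s) - (y : ℂ) ^ (-s + 1) / (-s + 1))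
          (n + 1) := by
  simp only [zetaApprox, Finset.sum_range_succ _ (n + 1)]
  push_cast
  rw [show (n : ℂ) + 1 + 1 = n + 2 by ring]
  ring

lemma norm_zetaApprox_sub_le (n : ℕ) {s : ℂ} (hs : s ≠ 1) (hre : -(3 / 2) < s.re)
    (hn : ‖s‖ < 4) :
    ‖zetaApprox (n + 2) s - zetaApprox (n + 1) s‖ ≤ 120 * ((n : ℝ) + 1) ^ (-(3 / 2) : ℝ) := by
  rw [zetaApprox_sub]
  have hpos : ∀ x ∈ Set.Icc (n + 1 : ℝ) (n + 2), 0 < x := fun x hx =>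
    n.cast_add_one_pos.trans_le hx.1
  refine (norm_image_sub_le_of_norm_deriv_le_segment' (C := 120 * ((n : ℝ) + 1) ^ (-(3 / 2) : ℝ))
    (fun x hx => (hasDerivAt_eulerMaclaurin_primitive hs (n + 1) (hpos x hx)).hasDerivWithinAt)
    (fun x hx => ?_) (n + 2) ⟨by linarith, le_rfl⟩).trans_eq (by ring)
  have hx0 := hpos x (Set.Ico_subset_Icc_self hx)
  have hB : ‖(((x - (n + 1 : ℝ)) ^ 3 - 3 / 2 * (x - (n + 1 : ℝ)) ^ 2
      + (x - (n + 1 : ℝ)) / 2) / 6 : ℂ)‖ ≤ 1 := by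
    obtain ⟨h1, h2⟩ := hx
    obtain ⟨t, rfl⟩ : ∃ t, x = n + 1 + t := ⟨x - (n + 1), by ring⟩
    have ht0 : 0 ≤ t := by linarith
    have ht1 : t ≤ 1 := by linarith
    rw [show (((((n + 1 + t : ℝ) : ℂ) - (n + 1 : ℝ)) ^ 3
      - 3 / 2 * (((n + 1 + t : ℝ) : ℂ) - (n + 1 : ℝ)) ^ 2
      + (((n + 1 + t : ℝ) : ℂ) - (n + 1 : ℝ)) / 2) / 6 : ℂ)
      = (((t ^ 3 - 3 / 2 * t ^ 2 + t / 2) / 6 : ℝ) : ℂ) by push_cast; ring]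
    rw [Complex.norm_real, Real.norm_eq_abs, abs_le]
    have h3 : t ^ 3 ≤ 1 := pow_le_one₀ ht0 ht1
    have h4 : t ^ 2 ≤ 1 := pow_le_one₀ ht0 ht1
    constructor <;> nlinarith [pow_nonneg ht0 3, pow_nonneg ht0 2]
  have h1 : ‖-s - 1‖ ≤ 5 := (norm_sub_le _ _).trans (by rw [norm_neg, norm_one]; linarith)
  have h2 : ‖-s - 2‖ ≤ 6 :=
    (norm_sub_le _ _).trans (by rw [norm_neg, Complex.norm_ofNat]; linarith)
  have h3 : ‖(x : ℂ) ^ (-s - 3)‖ ≤ ((n : ℝ) + 1) ^ (-(3 / 2) : ℝ) := by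
    rw [Complex.norm_cpow_eq_rpow_re_of_pos hx0]
    calc x ^ (-s - 3).re ≤ x ^ (-(3 / 2) : ℝ) := by
          apply Real.rpow_le_rpow_of_exponent_le
          · have := hx.1
            have : (0 : ℝ) ≤ n := n.cast_nonneg
            linarith
          · simp
            linarith
      _ ≤ _ := Real.rpow_le_rpow_of_nonpos (by positivity) hx.1 (by norm_num)
  rw [norm_mul, norm_mul, norm_mul, norm_mul, norm_neg]
  calc _ ≤ 1 * (4 * (5 * (6 * ((n : ℝ) + 1) ^ (-(3 / 2) : ℝ)))) := by gcongr
    _ = _ := by ring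

lemma differentiableAt_zetaApprox (n : ℕ) {s : ℂ} (hs : s ≠ 1) :
    DifferentiableAt ℂ (zetaApprox (n + 1)) s := by
  have hs' : -s + 1 ≠ 0 := fun h => hs (by linear_combination -h)
  have h0 : ∀ k : ℕ, (k : ℂ) + 1 ≠ 0 := fun k => Nat.cast_add_one_ne_zero k
  unfold zetaApprox
  push_cast
  have := h0 n
  refine ((DifferentiableAt.sub (DifferentiableAt.sub (DifferentiableAt.fun_sum fun k _ => ?_)
    ?_) ?_).add ?_)
  · exact DifferentiableAt.const_cpow (by fun_prop) (Or.inl (h0 k))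
  · exact (DifferentiableAt.const_cpow (by fun_prop) (Or.inl this)).div (by fun_prop) hs'
  · exact (DifferentiableAt.const_cpow (by fun_prop) (Or.inl this)).div_const _
  · exact (differentiableAt_id.mul
      (DifferentiableAt.const_cpow (by fun_prop) (Or.inl this))).div_const _

lemma tendsto_zetaApprox_of_one_lt_re {s : ℂ} (hs : 1 < s.re) :
    Tendsto (fun n => zetaApprox n s) atTop (nhds (riemannZeta s)) := by
  have hlim : ∀ p : ℂ, p.re < 0 → Tendsto (fun n : ℕ => (n : ℂ) ^ p) atTop (nhds 0) := by
    intro p hp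
    rw [tendsto_zero_iff_norm_tendsto_zero]
    have := (tendsto_rpow_neg_atTop (y := -p.re) (by linarith)).comp
      (tendsto_natCast_atTop_atTop (R := ℝ))
    refine this.congr' ?_
    filter_upwards [eventually_gt_atTop 0] with n hn
    rw [Complex.norm_natCast_cpow_of_pos hn]
    simp
  have hsum : HasSum (fun k : ℕ => ((k : ℂ) + 1) ^ (-s)) (riemannZeta s) := by
    rw [zeta_eq_tsum_one_div_nat_add_one_cpow hs]
    have h := (summable_nat_add_iff 1).2 (Complex.summable_one_div_nat_cpow.2 hs)
    convert! h.hasSum using 1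
    · ext k
      rw [Complex.cpow_neg]
      simp
    · simp
  have := ((hsum.tendsto_sum_nat.sub ((hlim (-s + 1) (by simp; linarith)).div_const (-s + 1))).sub
    ((hlim (-s) (by simp; linarith)).div_const 2)).add
    (((hlim (-s - 1) (by simp; linarith)).const_mul s).div_const 12)
  simpa [zetaApprox] using this

lemma tendsto_deriv_zetaApprox_neg_one :
    Tendsto (fun n => deriv (zetaApprox (n + 1)) (-1)) atTop (nhds (deriv riemannZeta (-1))) := by
  set U : Set ℂ := {s | 1 - s ∈ Complex.slitPlane} ∩ {s | -(3 / 2) < s.re} ∩ Metric.ball 0 4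
    with hU
  have hUo : IsOpen U := ((Complex.isOpen_slitPlane.preimage (by fun_prop)).inter
    (isOpen_lt continuous_const Complex.continuous_re)).inter Metric.isOpen_ball
  have hstar : StarConvex ℝ 0 U := by
    refine StarConvex.inter (StarConvex.inter ?_ ?_) ?_
    · intro y hy a b ha hb hab
      have := Complex.starConvex_one_slitPlane hy ha hb hab
      have e : 1 - (a • (0 : ℂ) + b • y) = a • (1 : ℂ) + b • (1 - y) := by
        have : (a : ℂ) + b = 1 := by exact_mod_cast hab
        simp only [Complex.real_smul]
        linear_combination -this
      simpa only [Set.mem_ofPred_eq, e] using this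
    · exact (convex_halfSpace_re_gt _).starConvex (by norm_num)
    · exact (convex_ball _ _).starConvex (by simp)
  have hUc : IsPreconnected U := (hstar.isPathConnected (by simp [hU])).isConnected.isPreconnected
  have hne : ∀ s ∈ U, s ≠ 1 := by
    rintro s hs rfl
    simpa using hs.1.1
  set D : ℕ → ℂ → ℂ := fun n s => zetaApprox (n + 2) s - zetaApprox (n + 1) s with hD
  have hDd : ∀ n, DifferentiableOn ℂ (D n) U := fun n s hs =>
    ((differentiableAt_zetaApprox (n + 1) (hne s hs)).sub
      (differentiableAt_zetaApprox n (hne s hs))).differentiableWithinAt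
  have hbd : ∀ n, ∀ s ∈ U, ‖D n s‖ ≤ 120 * ((n : ℝ) + 1) ^ (-(3 / 2) : ℝ) := fun n s hs =>
    norm_zetaApprox_sub_le n (hne s hs) hs.1.2 (by simpa using hs.2)
  have hsm : Summable fun n : ℕ => 120 * ((n : ℝ) + 1) ^ (-(3 / 2) : ℝ) := by
    have := (summable_nat_add_iff 1).2 (Real.summable_nat_rpow.2
      (show (-(3 / 2) : ℝ) < -1 by norm_num))
    simpa using this.mul_left 120
  have hone : DifferentiableOn ℂ (zetaApprox 1) U := fun s hs =>
    (differentiableAt_zetaApprox 0 (hne s hs)).differentiableWithinAt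
  have hzd : DifferentiableOn ℂ riemannZeta U := fun s hs =>
    (differentiableAt_riemannZeta (hne s hs)).differentiableWithinAt
  have hsumd : DifferentiableOn ℂ (fun s => ∑' n, D n s) U :=
    Complex.differentiableOn_tsum_of_summable_norm hsm hDd hUo hbd
  have htel : ∀ s n, ∑ i ∈ Finset.range n, D i s = zetaApprox (n + 1) s - zetaApprox 1 s :=
    fun s n => Finset.sum_range_sub (fun i => zetaApprox (i + 1) s) n
  have hz0 : (2 + Complex.I) ∈ U := by
    refine ⟨⟨?_, ?_⟩, ?_⟩
    · simp [Complex.mem_slitPlane_iff]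
    · norm_num
    · have : ‖2 + Complex.I‖ ≤ 2 + 1 := (norm_add_le _ _).trans (by simp)
      simp
      linarith
  have heq : Set.EqOn (fun s => ∑' n, D n s) (fun s => riemannZeta s - zetaApprox 1 s) U := by
    refine (hsumd.analyticOnNhd hUo).eqOn_of_preconnected_of_eventuallyEq
      ((hzd.sub hone).analyticOnNhd hUo) hUc hz0 ?_
    have h1 : {s : ℂ | 1 < s.re} ∈ nhds (2 + Complex.I) :=
      (isOpen_lt continuous_const Complex.continuous_re).mem_nhds (by norm_num)
    filter_upwards [h1, hUo.mem_nhds hz0] with s hs hsU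
    have hS : Summable fun n => D n s := .of_norm_bounded hsm fun n => hbd n s hsU
    refine tendsto_nhds_unique hS.hasSum.tendsto_sum_nat ?_
    simp_rw [htel]
    exact ((tendsto_zetaApprox_of_one_lt_re hs).comp (tendsto_add_atTop_nat 1)).sub_const _
  have hm : (-1 : ℂ) ∈ U := by
    refine ⟨⟨?_, ?_⟩, ?_⟩
    · left
      norm_num
    · norm_num
    · simp
  have hder := (Complex.hasSum_deriv_of_summable_norm hsm hDd hUo hbd hm).tendsto_sum_nat
  rw [(heq.eventuallyEq_of_mem (hUo.mem_nhds hm)).deriv_eq] at hder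
  have hd1 : ∀ n, DifferentiableAt ℂ (zetaApprox (n + 1)) (-1) := fun n =>
    differentiableAt_zetaApprox n (by norm_num)
  rw [deriv_fun_sub (differentiableAt_riemannZeta (by norm_num)) (hd1 0)] at hder
  have hs2 : ∀ n, ∑ i ∈ Finset.range n, deriv (D i) (-1)
      = deriv (zetaApprox (n + 1)) (-1) - deriv (zetaApprox 1) (-1) := fun n => by
    rw [← Finset.sum_range_sub (fun i => deriv (zetaApprox (i + 1)) (-1)) n]
    exact Finset.sum_congr rfl fun i _ => deriv_fun_sub (hd1 (i + 1)) (hd1 i)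
  simp_rw [hs2] at hder
  simpa using hder.add_const (deriv (zetaApprox 1) (-1))

lemma deriv_zetaApprox_neg_one (n : ℕ) :
    deriv (zetaApprox (n + 1)) (-1) =
      ((-∑ k ∈ Finset.range (n + 1), ((k : ℝ) + 1) * Real.log (k + 1)
        + ((n : ℝ) + 1) ^ 2 / 2 * Real.log (n + 1) - ((n : ℝ) + 1) ^ 2 / 4
        + ((n : ℝ) + 1) / 2 * Real.log (n + 1) + 1 / 12 + Real.log (n + 1) / 12 : ℝ) : ℂ) := by
  have h0 : ∀ k : ℕ, (k : ℂ) + 1 ≠ 0 := fun k => Nat.cast_add_one_ne_zero k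
  have hlog : ∀ k : ℕ, ((Real.log (k + 1) : ℝ) : ℂ) = Complex.log (k + 1) := fun k => by
    rw [Complex.ofReal_log (by positivity)]
    push_cast
    rfl
  have hneg : HasDerivAt (fun s : ℂ => -s) (-1) (-1) := hasDerivAt_neg _
  have hc : ∀ k : ℕ, HasDerivAt (fun s : ℂ => ((k : ℂ) + 1) ^ (-s)) _ (-1) := fun k =>
    hneg.const_cpow (Or.inl (h0 k))
  have hc1 := (hneg.add_const 1).const_cpow (c := (n : ℂ) + 1) (Or.inl (h0 n))
  have hc2 := (hneg.sub_const 1).const_cpow (c := (n : ℂ) + 1) (Or.inl (h0 n))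
  have H := (((HasDerivAt.fun_sum (u := Finset.range (n + 1)) fun k _ => hc k).sub
    (hc1.div (hneg.add_const 1) (by norm_num))).sub ((hc n).div_const 2)).add
    (((hasDerivAt_id (-1 : ℂ)).mul hc2).div_const 12)
  have e : zetaApprox (n + 1) = fun s => ∑ k ∈ Finset.range (n + 1), ((k : ℂ) + 1) ^ (-s)
      - ((n : ℂ) + 1) ^ (-s + 1) / (-s + 1) - ((n : ℂ) + 1) ^ (-s) / 2
      + s * ((n : ℂ) + 1) ^ (-s - 1) / 12 := by
    ext s
    simp [zetaApprox]
  rw [e]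
  refine (H.congr_deriv ?_ : HasDerivAt _ _ _).deriv
  push_cast
  simp only [hlog]
  have h2 : ((n : ℂ) + 1) ^ (1 + 1 : ℂ) = ((n : ℂ) + 1) ^ 2 := by
    rw [show (1 + 1 : ℂ) = (2 : ℕ) by norm_num, Complex.cpow_natCast]
  have h3 : ((n : ℂ) + 1) ^ (1 - 1 : ℂ) = 1 := by norm_num
  simp only [neg_neg, Complex.cpow_one, h2, h3]
  simp only [mul_neg, mul_one, Finset.sum_neg_distrib, id]
  ring

/-- The logarithm of the hyperfactorial `∏ k ≤ n, k ^ k`. -/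
noncomputable def logHyperfactorial (n : ℕ) : ℝ :=
  ∑ k ∈ Finset.range n, ((k : ℝ) + 1) * Real.log (k + 1)

lemma logHyperfactorial_succ (n : ℕ) :
    logHyperfactorial (n + 1) = logHyperfactorial n + ((n : ℝ) + 1) * Real.log (n + 1) :=
  Finset.sum_range_succ _ _

/-- The **Glaisher–Kinkelin** asymptotics of the hyperfactorial. -/
lemma tendsto_logHyperfactorial :
    Tendsto (fun n : ℕ => (((logHyperfactorial n - ((n : ℝ) ^ 2 / 2 * Real.log n - (n : ℝ) ^ 2 / 4
      + (n : ℝ) / 2 * Real.log n + 1 / 12 + Real.log n / 12) : ℝ) : ℂ)))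
      atTop (nhds (-deriv riemannZeta (-1))) := by
  rw [← tendsto_add_atTop_iff_nat 1]
  refine tendsto_deriv_zetaApprox_neg_one.neg.congr fun n => ?_
  rw [deriv_zetaApprox_neg_one, ← Complex.ofReal_neg, logHyperfactorial]
  congr 1
  push_cast
  ring

/-- The remainder in Stirling's formula is asymptotic to `1 / (12 n)`. -/
lemma tendsto_mul_log_stirlingSeq_sub :
    Tendsto (fun n : ℕ => (n : ℝ) * (Real.log (Stirling.stirlingSeq n) - Real.log (√Real.pi)))
      atTop (nhds (1 / 12)) := by
  have hpi : √Real.pi ≠ 0 := by positivity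
  set l : ℕ → ℝ := fun n => Real.log (Stirling.stirlingSeq n) - Real.log (√Real.pi) with hl
  have hl0 : Tendsto l atTop (nhds 0) := by
    simpa using! (Stirling.tendsto_stirlingSeq_sqrt_pi.log hpi).sub_const (Real.log (√Real.pi))
  have hinv : ∀ b : ℝ, Tendsto (fun n : ℕ => 1 / (12 * (n : ℝ) + b)) atTop (nhds 0) := fun b => by
    simp only [one_div]
    exact tendsto_inv_atTop_zero.comp (tendsto_atTop_add_const_right _ _
      (tendsto_natCast_atTop_atTop.const_mul_atTop (by norm_num)))
  have hup : ∀ n : ℕ, l (n + 1) ≤ 1 / (12 * ((n + 1 : ℕ) : ℝ) + 0) := fun n => by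
    have hm : Monotone fun k : ℕ => l (k + 1) - 1 / (12 * ((k + 1 : ℕ) : ℝ) + 0) := by
      refine monotone_nat_of_le_succ fun k => ?_
      have h := Stirling.log_stirlingSeq_sdiff_le (k + 1)
      have e : (1 : ℝ) / (12 * ((k + 1 : ℕ) : ℝ) * (((k + 1 : ℕ) : ℝ) + 1))
          = 1 / (12 * ((k + 1 : ℕ) : ℝ) + 0) - 1 / (12 * ((k + 1 + 1 : ℕ) : ℝ) + 0) := by
        push_cast
        field_simp
        ring
      simp only [hl]
      linarith
    have := hm.ge_of_tendsto (by
      simpa using! (hl0.comp (tendsto_add_atTop_nat 1)).sub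
        ((hinv 0).comp (tendsto_add_atTop_nat 1))) n
    linarith
  have hlow : ∀ n : ℕ, 1 / (12 * ((n + 1 : ℕ) : ℝ) + 1) ≤ l (n + 1) := fun n => by
    have hm : Antitone fun k : ℕ => l (k + 1) - 1 / (12 * ((k + 1 : ℕ) : ℝ) + 1) := by
      refine antitone_nat_of_succ_le fun k => ?_
      have h := le_hasSum (Stirling.log_stirlingSeq_sdiff_hasSum k) 0 fun _ _ => by positivity
      have e : (1 : ℝ) / (12 * ((k + 1 : ℕ) : ℝ) + 1) - 1 / (12 * ((k + 1 + 1 : ℕ) : ℝ) + 1)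
          ≤ 1 / (2 * ((0 + 1 : ℕ) : ℝ) + 1) * ((1 / (2 * ((k + 1 : ℕ) : ℝ) + 1)) ^ 2) ^ (0 + 1) := by
        have hk : (0 : ℝ) ≤ k := k.cast_nonneg
        push_cast
        rw [div_sub_div _ _ (by positivity) (by positivity), div_pow, pow_one,
          div_mul_div_comm, div_le_div_iff₀ (by positivity) (by positivity)]
        nlinarith
      simp only [hl]
      linarith
    have := hm.le_of_tendsto (by
      simpa using! (hl0.comp (tendsto_add_atTop_nat 1)).sub
        ((hinv 1).comp (tendsto_add_atTop_nat 1))) n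
    linarith
  rw [← tendsto_add_atTop_iff_nat 1]
  have hlim : Tendsto (fun n : ℕ => 1 / 12 - 1 / 12 * (1 / (12 * ((n + 1 : ℕ) : ℝ) + 1)))
      atTop (nhds (1 / 12)) := by
    have := (((hinv 1).comp (tendsto_add_atTop_nat 1)).const_mul (1 / 12)).const_sub (1 / 12)
    rwa [mul_zero, sub_zero] at this
  refine tendsto_of_tendsto_of_tendsto_of_le_of_le hlim tendsto_const_nhds
    (fun n => ?_) (fun n => ?_)
  · calc _ = ((n + 1 : ℕ) : ℝ) * (1 / (12 * ((n + 1 : ℕ) : ℝ) + 1)) := by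
          field_simp
          ring
      _ ≤ _ := by gcongr; exact hlow n
  · calc _ ≤ ((n + 1 : ℕ) : ℝ) * (1 / (12 * ((n + 1 : ℕ) : ℝ) + 0)) := by
          gcongr
          exact hup n
      _ = _ := by
        push_cast
        field_simp
        ring

lemma log_prod_legendre_norm_sq (n : ℕ) :
    Real.log (∏ k ∈ Finset.range n,
      (2 ^ (2 * k) * (k.factorial : ℝ) ^ 4 / ((2 * k).factorial : ℝ) ^ 2)
        * (2 / (2 * (k : ℝ) + 1))) =
      (n : ℝ) ^ 2 * Real.log 2 + 4 * n * Real.log n.factorial - 4 * logHyperfactorial n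
        - 2 * n * Real.log (2 * n).factorial + logHyperfactorial (2 * n) := by
  induction n with
  | zero => simp [logHyperfactorial]
  | succ n ih =>
    have hf : ∀ m : ℕ, (m.factorial : ℝ) ≠ 0 := fun m => by positivity
    have hfac : ∀ m : ℕ, Real.log (m + 1).factorial = Real.log (m + 1) + Real.log m.factorial :=
      fun m => by
        rw [Nat.factorial_succ, Nat.cast_mul, Real.log_mul (by positivity) (hf m)]
        push_cast
        rfl
    have h1 : (2 * (n : ℝ) + 1) ≠ 0 := by positivity
    have hprod := hf n
    have hprod' := hf (2 * n)
    rw [Finset.prod_range_succ, Real.log_mul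
      (Finset.prod_ne_zero_iff.2 fun k _ => by positivity) (by positivity), ih,
      Real.log_mul (by positivity) (by positivity), Real.log_div (by positivity) (by positivity),
      Real.log_mul (by positivity) (by positivity), Real.log_pow, Real.log_pow, Real.log_pow,
      Real.log_div (by norm_num) h1, show 2 * (n + 1) = 2 * n + 1 + 1 by ring,
      logHyperfactorial_succ, logHyperfactorial_succ, logHyperfactorial_succ, hfac, hfac, hfac]
    push_cast
    ring

lemma tendsto_log_prod_legendre_norm_sq_sub :
    Tendsto (fun n : ℕ => Real.log (∏ k ∈ Finset.range n,
      (2 ^ (2 * k) * (k.factorial : ℝ) ^ 4 / ((2 * k).factorial : ℝ) ^ 2)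
        * (2 / (2 * (k : ℝ) + 1)))
        - (n * Real.log (2 * Real.pi) - (n : ℝ) ^ 2 * Real.log 2 - 1 / 4 * Real.log n))
      atTop (nhds (1 / 12 * Real.log 2 + 3 * (deriv riemannZeta (-1)).re)) := by
  have hp := tendsto_mul_log_stirlingSeq_sub
  have hq : Tendsto (fun n : ℕ => logHyperfactorial n - ((n : ℝ) ^ 2 / 2 * Real.log n
      - (n : ℝ) ^ 2 / 4 + (n : ℝ) / 2 * Real.log n + 1 / 12 + Real.log n / 12))
      atTop (nhds (-(deriv riemannZeta (-1)).re)) :=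
    (Complex.continuous_re.tendsto _).comp tendsto_logHyperfactorial
  have h2 : Tendsto (fun n : ℕ => 2 * n) atTop atTop :=
    tendsto_id.const_mul_atTop' two_pos
  have H := ((((hp.const_mul 4).sub (hp.comp h2)).sub (hq.const_mul 4)).add
    (hq.comp h2)).add_const (1 / 12 * Real.log 2 - 1 / 4)
  convert! H.congr' ?_ using 2
  · ring
  filter_upwards [eventually_ge_atTop 1] with n hn
  have hn0 : (n : ℝ) ≠ 0 := by positivity
  have hpi := Real.pi_pos.ne'
  have hlog2 : Real.log (2 * n) = Real.log 2 + Real.log n := Real.log_mul two_ne_zero hn0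
  have hlog4 : Real.log (2 * (2 * n)) = Real.log 2 + (Real.log 2 + Real.log n) := by
    rw [Real.log_mul two_ne_zero (by positivity), hlog2]
  rw [log_prod_legendre_norm_sq]
  simp only [Function.comp_apply, Stirling.log_stirlingSeq_formula]
  push_cast
  rw [Real.log_div hn0 (Real.exp_ne_zero _), Real.log_div (by positivity) (Real.exp_ne_zero _),
    Real.log_exp, Real.log_sqrt Real.pi_pos.le, Real.log_mul two_ne_zero hpi, hlog4, hlog2]
  ring

/-- With
`A_n = ∏_{k=0}^{n−1} (2^{2k}(k!)^4/((2k)!)^2)·2/(2k+1)`, as `n → ∞`,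
`A_n = e^{c₀} n^{−1/4} (2π)^n 2^{−n²} (1 + o(1))`, where
`c₀ = (1/12) ln 2 + 3ζ'(−1)` is the Widom–Dyson constant. -/
theorem An_asymptotics :
    Tendsto (fun n : ℕ =>
        ((∏ k ∈ Finset.range n,
            (2 ^ (2 * k) * (k.factorial : ℝ) ^ 4 / ((2 * k).factorial : ℝ) ^ 2)
              * (2 / (2 * (k : ℝ) + 1)) : ℝ) : ℂ)
          / (Complex.exp ((1 / 12) * Real.log 2 + 3 * deriv riemannZeta (-1))
              * (n : ℂ) ^ (-(1 / 4) : ℂ)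
              * (2 * (Real.pi : ℂ)) ^ n
              * (2 : ℂ) ^ (-((n : ℤ) ^ 2))))
      atTop (nhds 1) := by
  obtain ⟨z, hz⟩ : ∃ z : ℝ, deriv riemannZeta (-1) = z := by
    have h1 := (Complex.continuous_im.tendsto _).comp tendsto_logHyperfactorial
    simp only [Function.comp_def, Complex.ofReal_im, Complex.neg_im] at h1
    exact ⟨_, Complex.ext rfl (neg_eq_zero.1 (tendsto_nhds_unique h1 tendsto_const_nhds))⟩
  have H := (Real.continuous_exp.tendsto _).comp (tendsto_log_prod_legendre_norm_sq_sub.sub_const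
    (1 / 12 * Real.log 2 + 3 * (deriv riemannZeta (-1)).re))
  rw [sub_self, Real.exp_zero, hz, Complex.ofReal_re] at H
  have H' := (Complex.continuous_ofReal.tendsto _).comp H
  rw [Complex.ofReal_one] at H'
  refine H'.congr' ?_
  filter_upwards [eventually_ge_atTop 1] with n hn
  have hn0 : (0 : ℝ) < n := by positivity
  have hA : 0 < ∏ k ∈ Finset.range n,
      (2 ^ (2 * k) * (k.factorial : ℝ) ^ 4 / ((2 * k).factorial : ℝ) ^ 2)
        * (2 / (2 * (k : ℝ) + 1)) :=
    Finset.prod_pos fun k _ => by positivity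
  simp only [Function.comp_apply]
  rw [hz, Real.exp_sub, Real.exp_sub, Real.exp_log hA, Real.exp_sub, Real.exp_sub, div_div]
  rw [Complex.ofReal_div]
  congr 1
  have e1 : Real.exp (n * Real.log (2 * Real.pi)) = (2 * Real.pi) ^ n := by
    rw [← Real.rpow_natCast, Real.rpow_def_of_pos (by positivity), mul_comm]
  have e2 : Real.exp ((n : ℝ) ^ 2 * Real.log 2) = 2 ^ (n ^ 2) := by
    rw [← Real.rpow_natCast 2 (n ^ 2), Real.rpow_def_of_pos two_pos, mul_comm, Nat.cast_pow]
  have e3 : Real.exp (1 / 4 * Real.log n) = ((n : ℝ) ^ (-(1 / 4) : ℝ))⁻¹ := by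
    rw [Real.rpow_def_of_pos hn0, ← Real.exp_neg]
    ring_nf
  have e4 : ((n : ℂ) ^ (-(1 / 4) : ℂ)) = (((n : ℝ) ^ (-(1 / 4) : ℝ) : ℝ) : ℂ) := by
    rw [Complex.ofReal_cpow hn0.le]
    push_cast
    rfl
  have e5 : (2 : ℂ) ^ (-((n : ℤ) ^ 2)) = ((2 : ℂ) ^ (n ^ 2))⁻¹ := by
    rw [zpow_neg, ← Nat.cast_pow, zpow_natCast]
  rw [e1, e2, e3, e4, e5]
  push_cast
  rw [div_inv_eq_mul]
  ring
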